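/- Let K ∈ L^∞(ℝ² \ B_1) be nonnegative and let v ∈ C²(ℝ² \ B_1) solve −Δv = K(x) e^v in ℝ² \ B_1 with ∫_{ℝ² \ B_1} e^{v(x)} dx < ∞. Then there exist a constant β < −2 and a constant C > 0 such that |v(x) − β ln|x|| ≤ C for all x with |x| sufficiently large. -/

import Mathlib

open MeasureTheory Metric Real Set
open scoped ENNReal NNReal

noncomputable section

/-- First-order partial derivative in direction `i`. -/
def pderiv1 {n : ℕ} (i : Fin n) (f : EuclideanSpace ℝ (Fin n) → ℝ) :
    EuclideanSpace ℝ (Fin n) → ℝ :=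
  fun x => fderiv ℝ f x (EuclideanSpace.single i 1)

/-- The Laplacian `Δf = ∑ ∂²f/∂xᵢ²`. -/
def lap {n : ℕ} (f : EuclideanSpace ℝ (Fin n) → ℝ) : EuclideanSpace ℝ (Fin n) → ℝ :=
  fun x => ∑ i, pderiv1 i (pderiv1 i f) x

/-- The negative Laplacian `-Δ`. -/
def nlap {n : ℕ} (f : EuclideanSpace ℝ (Fin n) → ℝ) : EuclideanSpace ℝ (Fin n) → ℝ :=
  fun x => -(lap f x)

/-- `(-Δ)^m`, the m-th iterate of the negative Laplacian. -/
def nlapIter {n : ℕ} (m : ℕ) (f : EuclideanSpace ℝ (Fin n) → ℝ) :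
    EuclideanSpace ℝ (Fin n) → ℝ :=
  nlap^[m] f

/-- `D^β`, the mixed partial derivative associated to a multi-index `β`. -/
def mderiv {n : ℕ} (β : Fin n → ℕ) (f : EuclideanSpace ℝ (Fin n) → ℝ) :
    EuclideanSpace ℝ (Fin n) → ℝ :=
  ((List.finRange n).foldr (fun i F => F ∘ (pderiv1 i)^[β i]) id) f

/-- The finset of multi-indices `β` with `|β| ≤ s`. -/
def degLE (n s : ℕ) : Finset (Fin n → ℕ) :=
  (Fintype.piFinset fun _ : Fin n => Finset.range (s+1)).filter fun β => ∑ i, β i ≤ s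

/-- The finset of multi-indices `β` with `|β| < s` (i.e. `|β| ≤ s - 1`; empty for `s = 0`). -/
def degLT (n s : ℕ) : Finset (Fin n → ℕ) :=
  (Fintype.piFinset fun _ : Fin n => Finset.range s).filter fun β => ∑ i, β i < s

/-- Fundamental-solution profile of `(-Δ)^m` on `ℝⁿ`:
`c‖x‖^{2m-n}` for `n > 2m` and `c ln(5/‖x‖)` for `n = 2m`. -/
def fundSol (m n : ℕ) (c : ℝ) : EuclideanSpace ℝ (Fin n) → ℝ :=
  fun x => if n = 2*m then c * Real.log (5 / ‖x‖) else c * ‖x‖ ^ ((2*m : ℤ) - n)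

/-- `ψ(x,y) = φ(x-y) - ∑_{|β| ≤ s-1} ((-y)^β/β!) D^β φ(x)`. -/
def psiFun (m n s : ℕ) (c : ℝ) (x y : EuclideanSpace ℝ (Fin n)) : ℝ :=
  fundSol m n c (x - y) -
    ∑ β ∈ degLT n s,
      ((∏ i, (-(y i)) ^ β i) / ∏ i, ((β i).factorial : ℝ)) * mderiv β (fundSol m n c) x

/-- `N(x) = ∫_{|y| ≤ 1} ψ(x,y) f(y) dy`. -/
def NFun (m n s : ℕ) (c : ℝ) (f : EuclideanSpace ℝ (Fin n) → ℝ)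
    (x : EuclideanSpace ℝ (Fin n)) : ℝ :=
  ∫ y in closedBall (0 : EuclideanSpace ℝ (Fin n)) 1, psiFun m n s c x y * f y

open Filter Topology Laplacian

theorem laplacian_eq_fderiv_fderiv (f : ℂ → ℝ) (z : ℂ) :
    Δ f z = fderiv ℝ (fderiv ℝ f) z 1 1 + fderiv ℝ (fderiv ℝ f) z Complex.I Complex.I := by
  simp [InnerProductSpace.laplacian_eq_iteratedFDeriv_complexPlane, iteratedFDeriv_two_apply]

theorem laplacian_comp_clm {g g' g'' : ℝ → ℝ} (hg : ∀ x, HasDerivAt g (g' x) x)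
    (hg' : ∀ x, HasDerivAt g' (g'' x) x) (l : ℂ →L[ℝ] ℝ) (z : ℂ) :
    Δ (fun z => g (l z)) z = g'' (l z) * (l 1 ^ 2 + l Complex.I ^ 2) := by
  have h1 : fderiv ℝ (fun z => g (l z)) = fun z => g' (l z) • l := by
    funext z
    exact ((hg (l z)).comp_hasFDerivAt z l.hasFDerivAt).fderiv
  have h2 : fderiv ℝ (fun z => g' (l z) • l) z = (g'' (l z) • l).smulRight l :=
    (((hg' (l z)).comp_hasFDerivAt z l.hasFDerivAt).smul_const l).fderiv
  rw [laplacian_eq_fderiv_fderiv, h1, h2]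
  simp
  ring

theorem ContDiffAt.hasDerivAt_fderiv_line {E F : Type*} [NormedAddCommGroup E] [NormedSpace ℝ E]
    [NormedAddCommGroup F] [NormedSpace ℝ F]
    {f : E → F} {z : E} (hf : ContDiffAt ℝ 2 f z) (a : E) :
    (∀ᶠ t : ℝ in 𝓝 0, HasDerivAt (fun t : ℝ => f (z + t • a)) (fderiv ℝ f (z + t • a) a) t) ∧
    HasDerivAt (fun t : ℝ => fderiv ℝ f (z + t • a) a) (fderiv ℝ (fderiv ℝ f) z a a) 0 := by
  have hl : ∀ t : ℝ, HasDerivAt (fun t : ℝ => z + t • a) a t := fun t => by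
    simpa using ((hasDerivAt_id t).smul_const a).const_add z
  have hc : Tendsto (fun t : ℝ => z + t • a) (𝓝 0) (𝓝 z) := by
    simpa using (hl 0).continuousAt.tendsto
  constructor
  · have h1 : ∀ᶠ y in 𝓝 z, ContDiffAt ℝ 2 f y := hf.eventually (by simp)
    filter_upwards [hc.eventually h1] with t ht
    exact (ht.differentiableAt (by simp)).hasFDerivAt.comp_hasDerivAt t (hl t)
  · have h2 : DifferentiableAt ℝ (fderiv ℝ f) z :=
      (hf.fderiv_right (m := 1) (by norm_num)).differentiableAt (by simp)
    have h3 : HasFDerivAt (fderiv ℝ f) (fderiv ℝ (fderiv ℝ f) z) (z + (0 : ℝ) • a) := by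
      simpa using h2.hasFDerivAt
    have h4 : HasDerivAt (fun t : ℝ => fderiv ℝ f (z + t • a)) (fderiv ℝ (fderiv ℝ f) z a) 0 :=
      h3.comp_hasDerivAt (0 : ℝ) (hl 0)
    exact (ContinuousLinearMap.apply ℝ F a).hasFDerivAt.comp_hasDerivAt (0 : ℝ) h4

theorem IsLocalMin.fderiv_fderiv_nonneg {E : Type*} [NormedAddCommGroup E] [NormedSpace ℝ E]
    {f : E → ℝ} {z : E} (h : IsLocalMin f z) (hf : ContDiffAt ℝ 2 f z) (a : E) :
    0 ≤ fderiv ℝ (fderiv ℝ f) z a a := by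
  obtain ⟨h1, h2⟩ := hf.hasDerivAt_fderiv_line a
  set g : ℝ → ℝ := fun t => f (z + t • a) with hg
  have hc : Tendsto (fun t : ℝ => z + t • a) (𝓝 0) (𝓝 z) := by
    have : Continuous (fun t : ℝ => z + t • a) := by fun_prop
    simpa using this.tendsto 0
  have hmin : IsLocalMin g 0 := by
    have : ∀ᶠ t in 𝓝 (0:ℝ), f z ≤ f (z + t • a) := hc.eventually h
    simpa [IsLocalMin, IsMinFilter, hg] using this
  have hd : deriv g =ᶠ[𝓝 0] fun t => fderiv ℝ f (z + t • a) a := by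
    filter_upwards [h1] with t ht using ht.deriv
  have hdd : deriv (deriv g) 0 = fderiv ℝ (fderiv ℝ f) z a a := by
    rw [hd.deriv_eq, h2.deriv]
  by_contra! hneg
  have hmax : IsLocalMax g 0 :=
    isLocalMax_of_deriv_deriv_neg (by rw [hdd]; exact hneg) hmin.deriv_eq_zero
      h1.self_of_nhds.continuousAt
  have hconst : g =ᶠ[𝓝 0] fun _ => g 0 := by
    filter_upwards [hmin, hmax] with t ht1 ht2 using le_antisymm ht2 ht1
  have : deriv (deriv g) 0 = 0 := by
    rw [hconst.deriv.deriv_eq]; simp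
  linarith

theorem IsLocalMin.laplacian_nonneg {f : ℂ → ℝ} {z : ℂ} (h : IsLocalMin f z)
    (hf : ContDiffAt ℝ 2 f z) : 0 ≤ Δ f z := by
  rw [laplacian_eq_fderiv_fderiv]
  exact add_nonneg (h.fderiv_fderiv_nonneg hf 1) (h.fderiv_fderiv_nonneg hf Complex.I)

theorem laplacian_comp_conformal {u : ℂ → ℝ} {g : ℂ → ℂ} {g' g'' : ℂ → ℂ}
    (hg : ∀ z, HasDerivAt g (g' z) z) (hg' : ∀ z, HasDerivAt g' (g'' z) z) {z : ℂ}
    (hu : ContDiffAt ℝ 2 u (g z)) :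
    Δ (fun z => u (g z)) z = ‖g' z‖ ^ 2 * Δ u (g z) := by
  have hgf : ∀ z, HasFDerivAt g ((g' z) • (1 : ℂ →L[ℝ] ℂ)) z := fun z =>
    (hg z).complexToReal_fderiv
  have hc : ContinuousAt g z := (hg z).continuousAt
  have h1 : fderiv ℝ (fun z => u (g z)) =ᶠ[𝓝 z]
      fun z => (fderiv ℝ u (g z)).comp ((g' z) • (1 : ℂ →L[ℝ] ℂ)) := by
    filter_upwards [hc.eventually (hu.eventually (by simp))] with y hy
    exact ((hy.differentiableAt (by simp)).hasFDerivAt.comp y (hgf y)).fderiv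
  have h2 : HasFDerivAt (fderiv ℝ u) (fderiv ℝ (fderiv ℝ u) (g z)) (g z) :=
    ((hu.fderiv_right (m := 1) (by norm_num)).differentiableAt (by simp)).hasFDerivAt
  have h3 : HasFDerivAt (fun z => fderiv ℝ u (g z)) _ z := h2.comp z (hgf z)
  have h4 : HasFDerivAt (fun z => (g' z) • (1 : ℂ →L[ℝ] ℂ)) _ z :=
    ((hg' z).complexToReal_fderiv).smul_const (1 : ℂ →L[ℝ] ℂ)
  have h5 := (h3.clm_comp h4).fderiv
  rw [laplacian_eq_fderiv_fderiv, h1.fderiv_eq, h5, laplacian_eq_fderiv_fderiv]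
  simp
  set D := fderiv ℝ (fderiv ℝ u) (g z)
  set c := g' z
  have e1 : c = c.re • (1 : ℂ) + c.im • Complex.I := by
    simp [Complex.re_add_im]
  have e2 : c * Complex.I = (-c.im) • (1 : ℂ) + c.re • Complex.I := by
    apply Complex.ext <;> simp
  have e3 : g'' z * Complex.I * Complex.I = - g'' z := by
    rw [mul_assoc, Complex.I_mul_I]; ring
  rw [e2, e3, map_neg, Complex.sq_norm, Complex.normSq_apply]
  generalize c.re = x at *
  generalize c.im = y at *
  rw [e1]
  simp only [map_add, map_smul, add_apply, smul_apply, smul_eq_mul]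
  ring

theorem hasDerivAt_intervalIntegral_of_continuousOn {F F' : ℝ → ℝ → ℝ} {s : Set ℝ}
    (hs : IsOpen s) {a b x : ℝ} (hx : x ∈ s)
    (hF : ContinuousOn (fun q : ℝ × ℝ => F q.1 q.2) (s ×ˢ univ))
    (hF' : ContinuousOn (fun q : ℝ × ℝ => F' q.1 q.2) (s ×ˢ univ))
    (hd : ∀ x ∈ s, ∀ t, HasDerivAt (fun x => F x t) (F' x t) x) :
    HasDerivAt (fun x => ∫ t in a..b, F x t) (∫ t in a..b, F' x t) x := by
  obtain ⟨ε, hε, hεs⟩ := Metric.isOpen_iff.1 hs x hx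
  have hcb : closedBall x (ε / 2) ⊆ s := (closedBall_subset_ball (by linarith)).trans hεs
  have hslice : ∀ {G : ℝ → ℝ → ℝ}, ContinuousOn (fun q : ℝ × ℝ => G q.1 q.2) (s ×ˢ univ) →
      ∀ y ∈ s, Continuous (G y) := by
    intro G hG y hy
    rw [← continuousOn_univ]
    exact hG.comp (f := fun t : ℝ => (y, t)) (by fun_prop) (fun t _ => ⟨hy, mem_univ _⟩)
  obtain ⟨C, hC⟩ := ((isCompact_closedBall x (ε / 2)).prod
    (isCompact_uIcc (a := a) (b := b))).exists_bound_of_continuousOn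
      (hF'.mono (prod_mono hcb (subset_univ _)))
  refine (intervalIntegral.hasDerivAt_integral_of_dominated_loc_of_deriv_le (F := F) (F' := F')
    (bound := fun _ => C) (s := closedBall x (ε / 2)) (closedBall_mem_nhds x (by linarith))
    ?_ ?_ ?_ ?_ ?_ ?_).2
  · filter_upwards [hs.mem_nhds hx] with y hy
    exact (hslice hF y hy).aestronglyMeasurable
  · exact (hslice hF x hx).intervalIntegrable _ _
  · exact (hslice hF' x hx).aestronglyMeasurable
  · exact ae_of_all _ fun t ht y hy => hC (y, t) ⟨hy, uIoc_subset_uIcc ht⟩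
  · exact intervalIntegrable_const
  · exact ae_of_all _ fun t _ y hy => hd y (hcb hy) t

/-- Sub-mean value property on circles. -/
theorem two_pi_mul_le_integral_circle {u : ℂ → ℝ} {p : ℂ} {R : ℝ}
    (hu : ContDiffOn ℝ 2 u (ball p R)) (hΔ : ∀ z ∈ ball p R, 0 ≤ Δ u z)
    {ρ : ℝ} (hρ : 0 < ρ) (hρR : ρ < R) :
    2 * π * u p ≤ ∫ θ in (-π)..π, u (p + ρ * Complex.exp (θ * Complex.I)) := by
  set g : ℂ → ℂ := fun z => p + Complex.exp z with hg
  set U : ℂ → ℝ := fun z => u (g z) with hU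
  set H : Set ℂ := {z | z.re < Real.log R} with hH
  have hR : 0 < R := hρ.trans hρR
  have hHo : IsOpen H := isOpen_lt Complex.continuous_re continuous_const
  have hgH : ∀ z ∈ H, g z ∈ ball p R := by
    intro z hz
    have h1 : Real.exp z.re < R := (Real.lt_log_iff_exp_lt hR).1 hz
    simpa [hg, Complex.norm_exp] using h1
  have hgd : ∀ z, HasDerivAt g (Complex.exp z) z := fun z => (Complex.hasDerivAt_exp z).const_add p
  have huat : ∀ z ∈ ball p R, ContDiffAt ℝ 2 u z := fun z hz =>
    hu.contDiffAt (isOpen_ball.mem_nhds hz)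
  have hgC : ContDiff ℝ 2 g := by
    have : ContDiff ℝ 2 Complex.exp := Complex.contDiff_exp
    exact contDiff_const.add this
  have hUat : ∀ z ∈ H, ContDiffAt ℝ 2 U z := fun z hz =>
    (huat _ (hgH z hz)).comp z hgC.contDiffAt
  have hUper : ∀ z, U (z + 2 * π * Complex.I) = U z := by
    intro z; simp [hU, hg, Complex.exp_periodic z]
  have hΔU : ∀ z ∈ H, 0 ≤ fderiv ℝ (fderiv ℝ U) z 1 1 +
      fderiv ℝ (fderiv ℝ U) z Complex.I Complex.I := by
    intro z hz
    rw [← laplacian_eq_fderiv_fderiv, hU,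
      laplacian_comp_conformal hgd Complex.hasDerivAt_exp (huat _ (hgH z hz))]
    exact mul_nonneg (by positivity) (hΔ _ (hgH z hz))
  have hD1 : ContinuousOn (fderiv ℝ U) H := fun z hz =>
    ((hUat z hz).fderiv_right (m := 1) (by norm_num)).continuousAt.continuousWithinAt
  have hD2 : ContinuousOn (fderiv ℝ (fderiv ℝ U)) H := fun z hz =>
    (((hUat z hz).fderiv_right (m := 1) (by norm_num)).fderiv_right (m := 0)
      (by norm_num)).continuousAt.continuousWithinAt
  have hU0 : ContinuousOn U H := fun z hz => (hUat z hz).continuousAt.continuousWithinAt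
  set L := Real.log R
  let c : ℝ → ℝ → ℂ := fun s θ => s + θ * Complex.I
  have hcH : ∀ s ∈ Iio L, ∀ θ, c s θ ∈ H := by
    intro s hs θ; simpa [c, hH] using hs
  have hcc : Continuous (fun q : ℝ × ℝ => c q.1 q.2) := by fun_prop
  have hmaps : MapsTo (fun q : ℝ × ℝ => c q.1 q.2) (Iio L ×ˢ univ) H := fun q hq => hcH _ hq.1 _
  have hline1 : ∀ s θ t : ℝ, c s θ + (t - s) • (1 : ℂ) = c t θ := by
    intro s θ t; simp [c]; ring
  have hline2 : ∀ s θ t : ℝ, c s θ + (t - θ) • Complex.I = c s t := by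
    intro s θ t; simp [c]; ring
  have hd1 : ∀ s ∈ Iio L, ∀ θ, HasDerivAt (fun s => U (c s θ)) (fderiv ℝ U (c s θ) 1) s := by
    intro s hs θ
    have := ((hUat _ (hcH s hs θ)).hasDerivAt_fderiv_line 1).1.self_of_nhds
    rw [← sub_self s] at this
    simpa only [hline1] using this.comp_sub_const s s
  have hd2 : ∀ s ∈ Iio L, ∀ θ, HasDerivAt (fun s => fderiv ℝ U (c s θ) 1)
      (fderiv ℝ (fderiv ℝ U) (c s θ) 1 1) s := by
    intro s hs θ
    have := ((hUat _ (hcH s hs θ)).hasDerivAt_fderiv_line 1).2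
    rw [← sub_self s] at this
    simpa only [hline1] using this.comp_sub_const s s
  have hd3 : ∀ s ∈ Iio L, ∀ θ, HasDerivAt (fun θ => fderiv ℝ U (c s θ) Complex.I)
      (fderiv ℝ (fderiv ℝ U) (c s θ) Complex.I Complex.I) θ := by
    intro s hs θ
    have := ((hUat _ (hcH s hs θ)).hasDerivAt_fderiv_line Complex.I).2
    rw [← sub_self θ] at this
    simpa only [hline2] using this.comp_sub_const θ θ
  have hE0 : ContinuousOn (fun q : ℝ × ℝ => U (c q.1 q.2)) (Iio L ×ˢ univ) :=
    hU0.comp hcc.continuousOn hmaps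
  have hE1 : ContinuousOn (fun q : ℝ × ℝ => fderiv ℝ U (c q.1 q.2) 1) (Iio L ×ˢ univ) :=
    (hD1.comp hcc.continuousOn hmaps).clm_apply continuousOn_const
  have hE2 : ∀ a, ContinuousOn (fun q : ℝ × ℝ => fderiv ℝ (fderiv ℝ U) (c q.1 q.2) a a)
      (Iio L ×ˢ univ) := fun a =>
    ((hD2.comp hcc.continuousOn hmaps).clm_apply continuousOn_const).clm_apply continuousOn_const
  have hcs : ∀ s ∈ Iio L, MapsTo (fun θ => c s θ) univ H := fun s hs θ _ => hcH s hs θ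
  have hcs' : ∀ s, Continuous (fun θ => c s θ) := fun s => by fun_prop
  have hS0 : ∀ s ∈ Iio L, Continuous (fun θ => U (c s θ)) := fun s hs =>
    continuousOn_univ.1 (hU0.comp (hcs' s).continuousOn (hcs s hs))
  have hS2 : ∀ s ∈ Iio L, ∀ a, Continuous (fun θ => fderiv ℝ (fderiv ℝ U) (c s θ) a a) :=
    fun s hs a => ((continuousOn_univ.1 (hD2.comp (hcs' s).continuousOn (hcs s hs))).clm_apply
      continuous_const).clm_apply continuous_const
  set A : ℝ → ℝ := fun s => ∫ θ in (-π)..π, U (c s θ) with hA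
  set A' : ℝ → ℝ := fun s => ∫ θ in (-π)..π, fderiv ℝ U (c s θ) 1 with hA'
  have hAd : ∀ s ∈ Iio L, HasDerivAt A (A' s) s := fun s hs =>
    hasDerivAt_intervalIntegral_of_continuousOn (F := fun s θ => U (c s θ)) isOpen_Iio hs hE0 hE1 hd1
  have hAd' : ∀ s ∈ Iio L, HasDerivAt A' (∫ θ in (-π)..π, fderiv ℝ (fderiv ℝ U) (c s θ) 1 1) s :=
    fun s hs => hasDerivAt_intervalIntegral_of_continuousOn
      (F := fun s θ => fderiv ℝ U (c s θ) 1) isOpen_Iio hs hE1 (hE2 1) hd2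
  have hper : ∀ s, fderiv ℝ U (c s π) = fderiv ℝ U (c s (-π)) := by
    intro s
    have h1 : c s π = c s (-π) + 2 * π * Complex.I := by simp [c]; ring
    rw [h1, ← fderiv_comp_add_right]
    simp_rw [hUper]
  have hA2 : ∀ s ∈ Iio L, 0 ≤ ∫ θ in (-π)..π, fderiv ℝ (fderiv ℝ U) (c s θ) 1 1 := by
    intro s hs
    have h1 : ∫ θ in (-π)..π, fderiv ℝ (fderiv ℝ U) (c s θ) Complex.I Complex.I = 0 := by
      rw [intervalIntegral.integral_eq_sub_of_hasDerivAt (fun θ _ => hd3 s hs θ)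
        ((hS2 s hs Complex.I).intervalIntegrable _ _), hper, sub_self]
    have h2 := intervalIntegral.integral_add (μ := volume)
      ((hS2 s hs 1).intervalIntegrable (-π) π)
      ((hS2 s hs Complex.I).intervalIntegrable (-π) π)
    rw [h1, add_zero] at h2
    rw [← h2]
    exact intervalIntegral.integral_nonneg (by linarith [pi_pos]) fun θ _ => hΔU _ (hcH s hs θ)
  have hmono' : MonotoneOn A' (Iio L) := by
    refine monotoneOn_of_deriv_nonneg (convex_Iio L)
      (fun s hs => (hAd' s hs).continuousAt.continuousWithinAt) ?_ ?_
    · rw [interior_Iio]; exact fun s hs => (hAd' s hs).differentiableAt.differentiableWithinAt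
    · rw [interior_Iio]; exact fun s hs => by rw [(hAd' s hs).deriv]; exact hA2 s hs
  have hp : ContDiffAt ℝ 2 u p := huat p (mem_ball_self hR)
  have hexp : Tendsto (fun s => Real.exp s) atBot (𝓝 0) := Real.tendsto_exp_atBot
  have hball : ∀ δ > 0, ∀ᶠ s in atBot, s ∈ Iio L ∧ ∀ θ, g (c s θ) ∈ ball p δ := by
    intro δ hδ
    filter_upwards [eventually_lt_atBot L, hexp.eventually (gt_mem_nhds hδ)] with s hs hs2
    exact ⟨hs, fun θ => by simpa [hg, c, Complex.norm_exp] using hs2⟩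
  have hA'lim : Tendsto A' atBot (𝓝 0) := by
    obtain ⟨C, hC⟩ : ∃ C, ∀ᶠ z in 𝓝 p, ‖fderiv ℝ u z‖ ≤ C := by
      refine ⟨‖fderiv ℝ u p‖ + 1, ?_⟩
      have := (hp.fderiv_right (m := 1) (by norm_num)).continuousAt.norm
      exact (this.eventually (gt_mem_nhds (lt_add_one _))).mono fun z hz => le_of_lt hz
    obtain ⟨δ, hδ, hδC⟩ := Metric.eventually_nhds_iff_ball.1 hC
    have hlim : Tendsto (fun s => C * Real.exp s * |π - -π|) atBot (𝓝 0) := by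
      simpa using (hexp.const_mul C).mul_const |π - -π|
    refine squeeze_zero_norm' ?_ hlim
    filter_upwards [hball δ hδ] with s hs
    refine intervalIntegral.norm_integral_le_of_norm_le_const fun θ _ => ?_
    have h1 : HasFDerivAt U _ (c s θ) :=
      ((huat _ (hgH _ (hcH s hs.1 θ))).differentiableAt (by simp)).hasFDerivAt.comp (c s θ)
        (hgd (c s θ)).complexToReal_fderiv
    rw [h1.fderiv]
    have h2 := (fderiv ℝ u (g (c s θ))).le_opNorm (Complex.exp (c s θ))
    have h3 : ‖Complex.exp (c s θ)‖ = Real.exp s := by simp [c, Complex.norm_exp]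
    rw [h3] at h2
    simp only [ContinuousLinearMap.comp_apply, smul_apply, one_apply_eq_self, smul_eq_mul, mul_one]
    exact h2.trans (mul_le_mul_of_nonneg_right (hδC _ (hs.2 θ)) (Real.exp_pos s).le)
  have hA'nonneg : ∀ s ∈ Iio L, 0 ≤ A' s := by
    intro s hs
    refine le_of_tendsto hA'lim ?_
    filter_upwards [eventually_le_atBot s] with t ht
    exact hmono' (lt_of_le_of_lt ht hs) hs ht
  have hmono : MonotoneOn A (Iio L) := by
    refine monotoneOn_of_deriv_nonneg (convex_Iio L)
      (fun s hs => (hAd s hs).continuousAt.continuousWithinAt) ?_ ?_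
    · rw [interior_Iio]; exact fun s hs => (hAd s hs).differentiableAt.differentiableWithinAt
    · rw [interior_Iio]; exact fun s hs => by rw [(hAd s hs).deriv]; exact hA'nonneg s hs
  have hsρ : Real.log ρ ∈ Iio L := Real.log_lt_log hρ hρR
  have hAρ : A (Real.log ρ) = ∫ θ in (-π)..π, u (p + ρ * Complex.exp (θ * Complex.I)) := by
    simp only [hA, hU, hg, c, Complex.exp_add]
    rw [← Complex.ofReal_exp, Real.exp_log hρ]
  rw [← hAρ]
  have key : ∀ ε > 0, 2 * π * (u p - ε) ≤ A (Real.log ρ) := by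
    intro ε hε
    have h1 : ∀ᶠ z in 𝓝 p, u p - ε < u z :=
      hp.continuousAt.eventually (lt_mem_nhds (by linarith))
    obtain ⟨δ, hδ, hδC⟩ := Metric.eventually_nhds_iff_ball.1 h1
    obtain ⟨s, ⟨hs, hs2⟩, hs3⟩ := ((hball δ hδ).and (eventually_le_atBot (Real.log ρ))).exists
    refine le_trans ?_ (hmono hs hsρ hs3)
    have h2 : ∫ θ in (-π)..π, (u p - ε) ≤ A s :=
      intervalIntegral.integral_mono_on (by linarith [pi_pos]) intervalIntegrable_const
        ((hS0 s hs).intervalIntegrable _ _) fun θ _ => (hδC _ (hs2 θ)).le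
    simp at h2
    linarith
  refine le_of_forall_pos_sub_le fun ε hε => ?_
  have := key (ε / (2 * π)) (by positivity)
  have h3 : 2 * π * (u p - ε / (2 * π)) = 2 * π * u p - ε := by field_simp
  linarith

theorem setIntegral_ball_eq_polar {u : ℂ → ℝ} {p : ℂ} {r : ℝ}
    (hu : ContinuousOn u (closedBall p r)) :
    ∫ z in ball p r, u z =
      ∫ ρ in Ioo 0 r, ∫ θ in Ioo (-π) π, ρ * u (p + ρ * Complex.exp (θ * Complex.I)) := by
  have h1 : ∫ z in ball p r, u z = ∫ z, (ball p r).indicator u (p + z) := by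
    rw [integral_add_left_eq_self (fun z => (ball p r).indicator u z) p,
      integral_indicator measurableSet_ball]
  have h2 : ∀ q ∈ polarCoord.target,
      q.1 • (ball p r).indicator u (p + Complex.polarCoord.symm q) =
      (Ioo 0 r ×ˢ Ioo (-π) π).indicator
        (fun q => q.1 * u (p + q.1 * Complex.exp (q.2 * Complex.I))) q := by
    intro q hq
    have hq1 : 0 < q.1 := hq.1
    have e : Complex.polarCoord.symm q = q.1 * Complex.exp (q.2 * Complex.I) := by
      rw [Complex.polarCoord_symm_apply, Complex.exp_mul_I]; simp
    have hn : ‖(q.1 : ℂ) * Complex.exp (q.2 * Complex.I)‖ = q.1 := by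
      rw [norm_mul, Complex.norm_exp_ofReal_mul_I, mul_one, Complex.norm_real, Real.norm_eq_abs,
        abs_of_pos hq1]
    rw [e]
    have hm : p + q.1 * Complex.exp (q.2 * Complex.I) ∈ ball p r ↔ q ∈ Ioo 0 r ×ˢ Ioo (-π) π := by
      rw [mem_ball, dist_eq_norm, add_sub_cancel_left, hn]
      exact ⟨fun h => ⟨⟨hq1, h⟩, hq.2⟩, fun h => h.1.2⟩
    by_cases h : q ∈ Ioo 0 r ×ˢ Ioo (-π) π
    · rw [indicator_of_mem h, indicator_of_mem (hm.2 h), smul_eq_mul]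
    · rw [indicator_of_notMem h, indicator_of_notMem (fun h' => h (hm.1 h')), smul_zero]
  have hms : MeasurableSet (Ioo 0 r ×ˢ Ioo (-π) π) := measurableSet_Ioo.prod measurableSet_Ioo
  rw [h1, ← Complex.integral_comp_polarCoord_symm,
    setIntegral_congr_fun polarCoord.open_target.measurableSet h2,
    setIntegral_indicator hms]
  have h3 : polarCoord.target ∩ Ioo 0 r ×ˢ Ioo (-π) π = Ioo 0 r ×ˢ Ioo (-π) π := by
    refine inter_eq_right.2 ?_
    exact prod_mono (fun x hx => hx.1) subset_rfl
  rw [h3, Measure.volume_eq_prod, setIntegral_prod]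
  have hc : ContinuousOn (fun q : ℝ × ℝ => q.1 * u (p + q.1 * Complex.exp (q.2 * Complex.I)))
      (Icc 0 r ×ˢ Icc (-π) π) := by
    refine continuousOn_fst.mul (hu.comp (by fun_prop) ?_)
    intro q hq
    rw [mem_closedBall, dist_eq_norm, add_sub_cancel_left, norm_mul,
      Complex.norm_exp_ofReal_mul_I, mul_one, Complex.norm_real, Real.norm_eq_abs,
      abs_of_nonneg hq.1.1]
    exact hq.1.2
  rw [← Measure.volume_eq_prod]
  exact (hc.integrableOn_compact (isCompact_Icc.prod isCompact_Icc)).mono_set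
    (prod_mono Ioo_subset_Icc_self Ioo_subset_Icc_self)

/-- Sub-mean value property on discs. -/
theorem mul_le_setIntegral_ball {u : ℂ → ℝ} {p : ℂ} {r R : ℝ} (hr : 0 ≤ r) (hrR : r < R)
    (hu : ContDiffOn ℝ 2 u (ball p R)) (hΔ : ∀ z ∈ ball p R, 0 ≤ Δ u z) :
    π * r ^ 2 * u p ≤ ∫ z in ball p r, u z := by
  have hcb : ContinuousOn u (closedBall p r) :=
    hu.continuousOn.mono (closedBall_subset_ball hrR)
  rw [setIntegral_ball_eq_polar hcb]
  have h1 : ∀ ρ : ℝ, ∫ θ in Ioo (-π) π, ρ * u (p + ρ * Complex.exp (θ * Complex.I)) =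
      ρ * ∫ θ in (-π)..π, u (p + ρ * Complex.exp (θ * Complex.I)) := by
    intro ρ
    rw [integral_const_mul, intervalIntegral.integral_of_le (by linarith [pi_pos]),
      integral_Ioc_eq_integral_Ioo]
  simp_rw [h1]
  rw [← integral_Ioc_eq_integral_Ioo, ← intervalIntegral.integral_of_le hr]
  have h2 : ∫ ρ in (0 : ℝ)..r, ρ * (2 * π * u p) = π * r ^ 2 * u p := by
    rw [intervalIntegral.integral_mul_const, integral_id]; ring
  rw [← h2]
  have hF : ContinuousOn (fun ρ : ℝ => ∫ θ in (-π)..π, u (p + ρ * Complex.exp (θ * Complex.I)))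
      (Icc 0 r) := by
    rw [continuousOn_iff_continuous_domRestrict]
    have : Continuous (fun q : Icc 0 r × ℝ => u (p + (q.1 : ℝ) * Complex.exp (q.2 * Complex.I))) := by
      refine hcb.comp_continuous (by fun_prop) ?_
      intro q
      rw [mem_closedBall, dist_eq_norm, add_sub_cancel_left, norm_mul,
        Complex.norm_exp_ofReal_mul_I, mul_one, Complex.norm_real, Real.norm_eq_abs,
        abs_of_nonneg q.1.2.1]
      exact q.1.2.2
    exact intervalIntegral.continuous_parametric_intervalIntegral_of_continuous' this _ _
  refine intervalIntegral.integral_mono_on hr ?_ ?_ ?_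
  · exact Continuous.intervalIntegrable (by fun_prop) _ _
  · refine ContinuousOn.intervalIntegrable ?_
    rw [uIcc_of_le hr]
    exact continuousOn_id.mul hF
  · intro ρ hρ
    rcases hρ.1.eq_or_lt with h0 | h0
    · simp [← h0]
    · exact mul_le_mul_of_nonneg_left
        (two_pi_mul_le_integral_circle hu hΔ h0 (hρ.2.trans_lt hrR)) h0.le

theorem integral_ball_const (p : ℂ) {r : ℝ} (hr : 0 ≤ r) (c : ℝ) :
    ∫ _ in ball p r, c = π * r ^ 2 * c := by
  simp [Measure.real, Complex.volume_ball, hr, mul_comm π]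

theorem laplacian_comp_re {g g' g'' : ℝ → ℝ} (hg : ∀ x, HasDerivAt g (g' x) x)
    (hg' : ∀ x, HasDerivAt g' (g'' x) x) (z : ℂ) :
    Δ (fun z : ℂ => g z.re) z = g'' z.re := by
  simpa using laplacian_comp_clm hg hg' Complex.reCLM z

theorem laplacian_mul_sq_dist (c : ℝ) (p z : ℂ) :
    Δ (fun z : ℂ => c * (z.re - p.re) ^ 2 + c * (z.im - p.im) ^ 2) z = 4 * c := by
  have hq : ∀ a x : ℝ, HasDerivAt (fun x => c * (x - a) ^ 2) (2 * c * (x - a)) x := by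
    intro a x
    convert! (((hasDerivAt_id x).sub_const a).pow 2).const_mul c using 1
    simp; ring
  have hq' : ∀ a x : ℝ, HasDerivAt (fun x => 2 * c * (x - a)) (2 * c) x := by
    intro a x
    simpa using ((hasDerivAt_id x).sub_const a).const_mul (2 * c)
  have h1 := laplacian_comp_clm (hq p.re) (hq' p.re) Complex.reCLM z
  have h2 := laplacian_comp_clm (hq p.im) (hq' p.im) Complex.imCLM z
  have hc1 : ContDiffAt ℝ 2 (fun z : ℂ => c * (Complex.reCLM z - p.re) ^ 2) z := by fun_prop
  have hc2 : ContDiffAt ℝ 2 (fun z : ℂ => c * (Complex.imCLM z - p.im) ^ 2) z := by fun_prop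
  have h3 := hc1.laplacian_add hc2
  rw [h1, h2] at h3
  simp at h3
  refine h3.trans ?_
  ring

/-- Approximate sub-mean value property for functions whose Laplacian is bounded below. -/
theorem mul_le_setIntegral_ball_add {u : ℂ → ℝ} {p : ℂ} {r R c : ℝ} (hr : 0 ≤ r) (hrR : r < R)
    (hc : 0 ≤ c) (hu : ContDiffOn ℝ 2 u (ball p R)) (hΔ : ∀ z ∈ ball p R, -c ≤ Δ u z) :
    π * r ^ 2 * u p ≤ (∫ z in ball p r, u z) + π * r ^ 2 * (c * r ^ 2 / 4) := by
  set q : ℂ → ℝ := fun z : ℂ => c / 4 * (z.re - p.re) ^ 2 + c / 4 * (z.im - p.im) ^ 2 with hq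
  have hqC : ContDiff ℝ 2 q := by
    have : ContDiff ℝ 2 (fun z : ℂ => c / 4 * (Complex.reCLM z - p.re) ^ 2 +
      c / 4 * (Complex.imCLM z - p.im) ^ 2) := by fun_prop
    exact this
  have h1 := mul_le_setIntegral_ball (u := u + q) hr hrR (hu.add hqC.contDiffOn) (fun z hz => by
    rw [(hu.contDiffAt (isOpen_ball.mem_nhds hz)).laplacian_add hqC.contDiffAt,
      laplacian_mul_sq_dist]
    linarith [hΔ z hz])
  have hI : ∀ {f : ℂ → ℝ}, ContinuousOn f (closedBall p r) → IntegrableOn f (ball p r) :=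
    fun hf => (hf.integrableOn_compact (isCompact_closedBall p r)).mono_set ball_subset_closedBall
  have hui := hI (hu.continuousOn.mono (closedBall_subset_ball hrR))
  have hqi := hI hqC.continuous.continuousOn
  have h2 : ∫ z in ball p r, (u + q) z = (∫ z in ball p r, u z) + ∫ z in ball p r, q z :=
    integral_add hui hqi
  have h3 : ∫ z in ball p r, q z ≤ ∫ _ in ball p r, c * r ^ 2 / 4 := by
    refine setIntegral_mono_on hqi (hI continuousOn_const) measurableSet_ball fun z hz => ?_
    have h4 : ‖z - p‖ ^ 2 ≤ r ^ 2 := by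
      have : ‖z - p‖ < r := by simpa [dist_eq_norm] using hz
      gcongr
    rw [Complex.sq_norm, Complex.normSq_apply] at h4
    simp only [Complex.sub_re, Complex.sub_im] at h4
    have := mul_le_mul_of_nonneg_left h4 (div_nonneg hc (by norm_num : (0:ℝ) ≤ 4))
    simp only [hq]
    linarith
  rw [integral_ball_const p hr] at h3
  have h5 : (u + q) p = u p := by simp [hq]
  rw [h5, h2] at h1
  linarith

/-- Harnack inequality on discs for nonnegative functions with bounded, nonnegative Laplacian. -/
theorem le_four_mul_add_of_laplacian_mem_Icc {u : ℂ → ℝ} {p q : ℂ} {r R c : ℝ} (hr : 0 < r)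
    (hR : 3 * r < R) (hu : ContDiffOn ℝ 2 u (ball q R)) (h0 : ∀ z ∈ ball q R, 0 ≤ u z)
    (hΔ0 : ∀ z ∈ ball q R, 0 ≤ Δ u z) (hΔ : ∀ z ∈ ball q R, Δ u z ≤ c)
    (hp : dist p q ≤ r) : u p ≤ 4 * (u q + c * r ^ 2) := by
  have hsub1 : ball p (2 * r) ⊆ ball q R := by
    refine ball_subset_ball' (by linarith)
  have hsub2 : ball p r ⊆ ball q (2 * r) := ball_subset_ball' (by linarith)
  have hc : 0 ≤ c := (hΔ0 q (mem_ball_self (by linarith))).trans (hΔ q (mem_ball_self (by linarith)))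
  have h1 := mul_le_setIntegral_ball hr.le (by linarith : r < 2 * r) (hu.mono hsub1)
    (fun z hz => hΔ0 z (hsub1 hz))
  have hi : IntegrableOn u (ball q (2 * r)) :=
    ((hu.continuousOn.mono (closedBall_subset_ball (by linarith))).integrableOn_compact
      (isCompact_closedBall q (2 * r))).mono_set ball_subset_closedBall
  have h2 : ∫ z in ball p r, u z ≤ ∫ z in ball q (2 * r), u z := by
    refine setIntegral_mono_set hi ?_ hsub2.eventuallyLE
    filter_upwards [ae_restrict_mem measurableSet_ball] with z hz
    exact h0 z (ball_subset_ball (by linarith) hz)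
  have h3 := mul_le_setIntegral_ball_add (u := -u) (p := q) (by linarith : 0 ≤ 2 * r)
    (by linarith : 2 * r < R) hc hu.neg (fun z hz => by
      rw [InnerProductSpace.laplacian_neg]; simpa using hΔ z hz)
  simp only [Pi.neg_apply, integral_neg] at h3
  have h4 : π * r ^ 2 * u p ≤ π * r ^ 2 * (4 * (u q + c * r ^ 2)) := by
    nlinarith [h1, h2, h3]
  exact le_of_mul_le_mul_left h4 (by positivity)

theorem isOpen_lt_re (T : ℝ) : IsOpen {z : ℂ | T < z.re} :=
  isOpen_lt continuous_const Complex.continuous_re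

theorem exists_mem_reProdIm_of_periodic {W : ℂ → ℝ}
    (hper : ∀ z, W (z + 2 * π * Complex.I) = W z) (z : ℂ) :
    ∃ y ∈ Ico 0 (2 * π), W z = W (z.re + y * Complex.I) := by
  have hp : Function.Periodic (fun y : ℝ => W (z.re + y * Complex.I)) (2 * π) := by
    intro y
    simp only
    rw [← hper (z.re + y * Complex.I)]
    congr 1
    push_cast
    ring
  obtain ⟨y, hy, h⟩ := hp.exists_mem_Ico₀ (by positivity) z.im
  refine ⟨y, hy, ?_⟩
  rw [← h, Complex.re_add_im]

/-- Comparison of a superharmonic function on a half-cylinder with affine functions. -/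
theorem affine_le_of_laplacian_nonpos {W : ℂ → ℝ} {T t₁ t₂ a b : ℝ} (hT : T < t₁)
    (hW : ContDiffOn ℝ 2 W {z | T < z.re}) (hper : ∀ z, W (z + 2 * π * Complex.I) = W z)
    (hΔ : ∀ z : ℂ, T < z.re → Δ W z ≤ 0) (h₁ : ∀ z : ℂ, z.re = t₁ → a ≤ W z)
    (h₂ : ∀ z : ℂ, z.re = t₂ → a + b * (t₂ - t₁) ≤ W z) {z : ℂ} (hz₁ : t₁ ≤ z.re)
    (hz₂ : z.re ≤ t₂) : a + b * (z.re - t₁) ≤ W z := by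
  have key : ∀ δ > 0, 0 ≤ W z + (δ * ((z.re - t₁) * (t₂ - z.re)) - a - b * (z.re - t₁)) := by
    intro δ hδ
    set g : ℝ → ℝ := fun x => δ * ((x - t₁) * (t₂ - x)) - a - b * (x - t₁) with hg
    have hgd : ∀ x, HasDerivAt g (δ * (t₂ + t₁ - 2 * x) - b) x := by
      intro x
      have h1 : HasDerivAt (fun x => x - t₁) 1 x := (hasDerivAt_id x).sub_const t₁
      have h2 : HasDerivAt (fun x => t₂ - x) (-1) x := (hasDerivAt_id x).const_sub t₂
      convert! (((h1.mul h2).const_mul δ).sub_const a).sub (h1.const_mul b) using 1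
      ring
    have hgd' : ∀ x, HasDerivAt (fun x => δ * (t₂ + t₁ - 2 * x) - b) (-2 * δ) x := by
      intro x
      convert! ((((hasDerivAt_id x).const_mul 2).const_sub (t₂ + t₁)).const_mul δ).sub_const b
        using 1
      ring
    have hgC : ContDiff ℝ 2 (fun z : ℂ => g z.re) := by
      have : ContDiff ℝ 2 (fun z : ℂ => g (Complex.reCLM z)) := by
        simp only [hg]; fun_prop
      exact this
    set F : ℂ → ℝ := W + fun z => g z.re with hF
    have hFper : ∀ z, F (z + 2 * π * Complex.I) = F z := by
      intro z; simp [hF, hper]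
    set Q : Set ℂ := Icc t₁ t₂ ×ℂ Icc 0 (2 * π) with hQ
    have hFQ : ContinuousOn F Q := by
      refine (hW.continuousOn.mono ?_).add hgC.continuous.continuousOn
      intro z hz
      exact hT.trans_le hz.1.1
    have hQc : IsCompact Q := isCompact_Icc.reProdIm isCompact_Icc
    have hQn : Q.Nonempty :=
      ⟨z.re, by simp [hQ, Complex.mem_reProdIm, hz₁, hz₂, pi_pos.le]⟩
    obtain ⟨z₀, hz₀, hmin⟩ := hQc.exists_isMinOn hQn hFQ
    have hmin' : ∀ z : ℂ, t₁ ≤ z.re → z.re ≤ t₂ → F z₀ ≤ F z := by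
      intro z h1 h2
      obtain ⟨y, hy, h⟩ := exists_mem_reProdIm_of_periodic hFper z
      rw [h]
      exact hmin (by simp [hQ, Complex.mem_reProdIm, h1, h2, hy.1, hy.2.le])
    suffices h0 : 0 ≤ F z₀ from h0.trans (hmin' z hz₁ hz₂)
    obtain ⟨hl, hr⟩ := hz₀.1
    rcases hl.eq_or_lt with hl | hl
    · have := h₁ z₀ hl.symm
      simp only [hF, Pi.add_apply, hg, ← hl]
      simp
      linarith
    rcases hr.eq_or_lt with hr | hr
    · have := h₂ z₀ hr
      simp only [hF, Pi.add_apply, hg, hr]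
      simp
      linarith
    exfalso
    have hloc : IsLocalMin F z₀ := by
      filter_upwards [(isOpen_lt_re t₁).mem_nhds hl,
        (isOpen_lt Complex.continuous_re continuous_const).mem_nhds hr] with z h1 h2
      exact hmin' z h1.le (le_of_lt h2)
    have hWat : ContDiffAt ℝ 2 W z₀ := hW.contDiffAt ((isOpen_lt_re T).mem_nhds (hT.trans hl))
    have h3 := hloc.laplacian_nonneg (hWat.add hgC.contDiffAt)
    rw [hWat.laplacian_add hgC.contDiffAt, laplacian_comp_re hgd hgd'] at h3
    linarith [hΔ z₀ (hT.trans hl)]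
  have hP : 0 ≤ (z.re - t₁) * (t₂ - z.re) :=
    mul_nonneg (sub_nonneg.2 hz₁) (sub_nonneg.2 hz₂)
  refine le_of_forall_pos_sub_le fun ε hε => ?_
  have h := key (ε / ((z.re - t₁) * (t₂ - z.re) + 1)) (by positivity)
  have h2 : ε / ((z.re - t₁) * (t₂ - z.re) + 1) * ((z.re - t₁) * (t₂ - z.re)) ≤ ε := by
    rw [div_mul_eq_mul_div, div_le_iff₀ (by positivity)]
    nlinarith
  linarith

/-- Small energy implies an upper bound, for `-ΔW ≤ M e^W`. -/
theorem exists_pos_forall_nonpos_of_setIntegral_exp_lt {M : ℝ} (hM : 0 ≤ M) :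
    ∃ η > 0, ∀ (W : ℂ → ℝ) (q : ℂ) (R : ℝ), 1 < R → ContDiffOn ℝ 2 W (ball q R) →
      (∀ z ∈ ball q R, -(M * Real.exp (W z)) ≤ Δ W z) →
      ∫ z in ball q 1, Real.exp (W z) < η → W q ≤ 0 := by
  set κ : ℝ := 1 / (2 * (M + 1)) with hκ
  have hκ0 : 0 < κ := by positivity
  have hκ2 : κ ≤ 1 / 2 := by
    rw [hκ, div_le_div_iff₀ (by positivity) (by norm_num)]; linarith
  have hκM : M * κ ≤ 1 / 2 := by
    rw [hκ, mul_one_div, div_le_div_iff₀ (by positivity) (by norm_num)]; linarith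
  refine ⟨π * κ ^ 2 / 2, by positivity, fun W q R hR hW hΔ hint => ?_⟩
  by_contra! hq
  set φ : ℂ → ℝ := fun z => Real.exp (W z) * (1 - dist z q) ^ 2 with hφ
  have hWc : ContinuousOn W (closedBall q 1) :=
    hW.continuousOn.mono (closedBall_subset_ball hR)
  have hφc : ContinuousOn φ (closedBall q 1) :=
    (Real.continuous_exp.comp_continuousOn hWc).mul (by fun_prop)
  obtain ⟨p, hp, hmax⟩ := (isCompact_closedBall q 1).exists_isMaxOn
    ⟨q, mem_closedBall_self zero_le_one⟩ hφc
  have hφp : 1 < φ p := by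
    refine lt_of_lt_of_le ?_ (hmax (mem_closedBall_self zero_le_one))
    simpa [hφ] using hq
  set d : ℝ := 1 - dist p q with hd
  have hd0 : 0 ≤ d := by rw [hd]; linarith [mem_closedBall.1 hp]
  set lam : ℝ := Real.exp (-(W p) / 2) with hlam
  have hlam0 : 0 < lam := Real.exp_pos _
  have hlamW : Real.exp (W p) * lam ^ 2 = 1 := by
    rw [hlam, ← Real.exp_nat_mul, ← Real.exp_add]
    simp; ring
  have hlamd : lam < d := by
    have : Real.exp (W p) * lam ^ 2 < Real.exp (W p) * d ^ 2 := by rw [hlamW]; exact hφp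
    exact lt_of_pow_lt_pow_left₀ 2 hd0 (lt_of_mul_lt_mul_left this (Real.exp_pos _).le)
  have hsub : ball p (d / 2) ⊆ ball q 1 := ball_subset_ball' (by rw [hd]; linarith [dist_nonneg (x := p) (y := q)])
  have hbound : ∀ z ∈ ball p (d / 2), Real.exp (W z) ≤ 4 * Real.exp (W p) := by
    intro z hz
    have h1 : φ z ≤ φ p := hmax (ball_subset_closedBall (hsub hz))
    have h2 : d / 2 ≤ 1 - dist z q := by
      have := dist_triangle z p q
      have := mem_ball.1 hz
      rw [hd] at *; linarith
    have h3 : Real.exp (W z) * (d / 2) ^ 2 ≤ Real.exp (W p) * d ^ 2 := by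
      exact le_trans (mul_le_mul_of_nonneg_left (pow_le_pow_left₀ (by linarith) h2 2)
        (Real.exp_pos _).le) h1
    have h4 : Real.exp (W z) * d ^ 2 ≤ 4 * Real.exp (W p) * d ^ 2 := by linarith
    exact le_of_mul_le_mul_right h4 (by have := hlam0.trans hlamd; positivity)
  set r : ℝ := κ * lam with hr
  have hr0 : 0 < r := by positivity
  have hrd : r < d / 2 := by
    have : κ * lam ≤ 1 / 2 * lam := by gcongr
    linarith
  have h1 := mul_le_setIntegral_ball_add (c := 4 * M * Real.exp (W p)) hr0.le hrd (by positivity)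
    (hW.mono (hsub.trans (ball_subset_ball hR.le))) (fun z hz => by
      have h5 := hΔ z (ball_subset_ball hR.le (hsub hz))
      have h6 := mul_le_mul_of_nonneg_left (hbound z hz) hM
      linarith)
  have h2 : 4 * M * Real.exp (W p) * r ^ 2 / 4 ≤ 1 / 2 := by
    have : 4 * M * Real.exp (W p) * r ^ 2 / 4 = (M * κ) * κ * (Real.exp (W p) * lam ^ 2) := by
      rw [hr]; ring
    rw [this, hlamW]
    nlinarith [mul_nonneg hM hκ0.le]
  have hI : ∀ {f : ℂ → ℝ}, ContinuousOn f (closedBall q 1) → IntegrableOn f (ball q 1) :=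
    fun hf => (hf.integrableOn_compact (isCompact_closedBall q 1)).mono_set ball_subset_closedBall
  have hrsub : ball p r ⊆ ball q 1 := (ball_subset_ball hrd.le).trans hsub
  have hexpI := hI (Real.continuous_exp.comp_continuousOn hWc)
  have h3 : ∫ z in ball p r, (Real.exp (W p) * ((1 - W p) + W z)) ≤
      ∫ z in ball p r, Real.exp (W z) := by
    refine setIntegral_mono_on ((hI (continuousOn_const.mul (continuousOn_const.add hWc))).mono_set
      hrsub) (hexpI.mono_set hrsub) measurableSet_ball fun z _ => ?_
    have h4 : Real.exp (W z) = Real.exp (W p) * Real.exp (W z - W p) := by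
      rw [← Real.exp_add]; ring_nf
    rw [h4]
    gcongr
    linarith [Real.add_one_le_exp (W z - W p)]
  have h4 : ∫ z in ball p r, Real.exp (W z) ≤ ∫ z in ball q 1, Real.exp (W z) :=
    setIntegral_mono_set hexpI (ae_of_all _ fun z => (Real.exp_pos _).le) hrsub.eventuallyLE
  rw [integral_const_mul, integral_add ((hI continuousOn_const).mono_set hrsub) ((hI hWc).mono_set hrsub),
    integral_ball_const p hr0.le] at h3
  have h5 : π * r ^ 2 * (1 / 2) ≤ π * r ^ 2 * (1 - W p) + ∫ z in ball p r, W z := by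
    have := mul_le_mul_of_nonneg_left h2 (by positivity : 0 ≤ π * r ^ 2)
    linarith
  have h6 : π * κ ^ 2 / 2 = Real.exp (W p) * (π * r ^ 2 * (1 / 2)) := by
    have : Real.exp (W p) * (π * r ^ 2 * (1 / 2)) = π * κ ^ 2 / 2 * (Real.exp (W p) * lam ^ 2) := by
      rw [hr]; ring
    rw [this, hlamW, mul_one]
  have h7 := mul_le_mul_of_nonneg_left h5 (Real.exp_pos (W p)).le
  linarith

/-- Harnack inequality on the circles of a half-cylinder. -/
theorem harnack_of_periodic {G : ℂ → ℝ} {T c : ℝ} (hG : ContDiffOn ℝ 2 G {z | T < z.re})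
    (hper : ∀ z, G (z + 2 * π * Complex.I) = G z) (h0 : ∀ z : ℂ, T < z.re → 0 ≤ G z)
    (hΔ0 : ∀ z : ℂ, T < z.re → 0 ≤ Δ G z) (hΔ : ∀ z : ℂ, T < z.re → Δ G z ≤ c) {p q : ℂ}
    (hpq : p.re = q.re) (hq : T + 22 ≤ q.re) : G p ≤ 4 * (G q + 49 * c) := by
  obtain ⟨x, hx, hpx⟩ := exists_mem_reProdIm_of_periodic hper p
  obtain ⟨y, hy, hqy⟩ := exists_mem_reProdIm_of_periodic hper q
  rw [hpx, hqy, hpq]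
  have hsub : ∀ z ∈ ball ((q.re : ℂ) + y * Complex.I) 22, T < z.re := by
    intro z hz
    rw [mem_ball, dist_eq_norm] at hz
    have := (abs_lt.1 ((Complex.abs_re_le_norm _).trans_lt hz)).1
    simp at this
    linarith
  have hd : dist ((q.re : ℂ) + x * Complex.I) ((q.re : ℂ) + y * Complex.I) ≤ 7 := by
    rw [dist_eq_norm, add_sub_add_left_eq_sub, ← sub_mul, norm_mul, Complex.norm_I, mul_one,
      ← Complex.ofReal_sub, Complex.norm_real, Real.norm_eq_abs, abs_le]
    have := pi_lt_d2
    constructor <;> linarith [hx.1, hx.2, hy.1, hy.2]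
  have := le_four_mul_add_of_laplacian_mem_Icc (by norm_num : (0 : ℝ) < 7)
    (by norm_num : (3 : ℝ) * 7 < 22) (hG.mono hsub) (fun z hz => h0 z (hsub z hz))
    (fun z hz => hΔ0 z (hsub z hz)) (fun z hz => hΔ z (hsub z hz)) hd
  linarith

theorem exists_isMinOn_circle {W : ℂ → ℝ} {T t : ℝ} (hT : T < t)
    (hW : ContinuousOn W {z | T < z.re}) (hper : ∀ z, W (z + 2 * π * Complex.I) = W z) :
    ∃ z₀ : ℂ, z₀.re = t ∧ ∀ z : ℂ, z.re = t → W z₀ ≤ W z := by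
  have hc : IsCompact (({t} : Set ℝ) ×ℂ Icc 0 (2 * π)) := isCompact_singleton.reProdIm isCompact_Icc
  obtain ⟨z₀, hz₀, hmin⟩ := hc.exists_isMinOn ⟨t, by simp [Complex.mem_reProdIm, pi_pos.le]⟩
    (hW.mono fun z hz => by rw [mem_ofPred_eq, mem_singleton_iff.1 hz.1]; exact hT)
  refine ⟨z₀, hz₀.1, fun z hz => ?_⟩
  obtain ⟨y, hy, h⟩ := exists_mem_reProdIm_of_periodic hper z
  rw [h]
  exact hmin (by simp [Complex.mem_reProdIm, hz, hy.1, hy.2.le])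

/-- A superharmonic function on a half-cylinder which is bounded below by some affine function
`C + s * t` is bounded below by an affine function of the same slope which is sharp at `t = t₀`. -/
theorem affine_le_of_laplacian_nonpos_of_le {W : ℂ → ℝ} {T t₀ a C s : ℝ} (hT : T < t₀)
    (hW : ContDiffOn ℝ 2 W {z | T < z.re}) (hper : ∀ z, W (z + 2 * π * Complex.I) = W z)
    (hΔ : ∀ z : ℂ, T < z.re → Δ W z ≤ 0) (h₁ : ∀ z : ℂ, z.re = t₀ → a ≤ W z)
    (h₂ : ∀ N : ℝ, ∃ t, N ≤ t ∧ ∀ z : ℂ, z.re = t → C + s * t ≤ W z) {z : ℂ} (hz : t₀ ≤ z.re) :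
    a + s * (z.re - t₀) ≤ W z := by
  have key : ∀ δ > 0, a + (s - δ) * (z.re - t₀) ≤ W z := by
    intro δ hδ
    obtain ⟨t, ht, h⟩ := h₂ (max z.re ((a - s * t₀ + δ * t₀ - C) / δ))
    have ht2 : a - s * t₀ + δ * t₀ - C ≤ t * δ := (div_le_iff₀ hδ).1 ((le_max_right _ _).trans ht)
    refine affine_le_of_laplacian_nonpos (t₂ := t) hT hW hper hΔ h₁ (fun w hw => ?_) hz
      ((le_max_left _ _).trans ht)
    linarith [h w hw]
  refine le_of_forall_pos_sub_le fun ε hε => ?_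
  have h0 : 0 ≤ z.re - t₀ := sub_nonneg.2 hz
  have h := key (ε / (z.re - t₀ + 1)) (by positivity)
  have h2 : ε / (z.re - t₀ + 1) * (z.re - t₀) ≤ ε := by
    rw [div_mul_eq_mul_div, div_le_iff₀ (by positivity)]
    nlinarith
  linarith

theorem sub_lt_re_of_mem_ball {q z : ℂ} {r : ℝ} (hz : z ∈ ball q r) : q.re - r < z.re := by
  rw [mem_ball, dist_eq_norm] at hz
  have := (abs_lt.1 ((Complex.abs_re_le_norm _).trans_lt hz)).1
  simp at this
  linarith

section HalfCylinder

variable {W : ℂ → ℝ} {M : ℝ}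

/-- Exponential decay of finite-energy solutions on a half-cylinder. -/
theorem exists_le_sub_mul_re (hM : 0 ≤ M) (hW : ContDiffOn ℝ 2 W {z | 0 < z.re})
    (hper : ∀ z, W (z + 2 * π * Complex.I) = W z) (hΔ0 : ∀ z : ℂ, 0 < z.re → Δ W z ≤ 0)
    (hΔ : ∀ z : ℂ, 0 < z.re → -(M * Real.exp (W z)) ≤ Δ W z)
    (hint : ∀ η > 0, ∃ T : ℝ, ∀ q : ℂ, T ≤ q.re → ∫ z in ball q 1, Real.exp (W z) < η) :
    ∃ ε > 0, ∃ C T : ℝ, 0 < T ∧ ∀ z : ℂ, T ≤ z.re → W z ≤ 0 ∧ W z ≤ C - ε * z.re := by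
  obtain ⟨η, hη, hreg⟩ := exists_pos_forall_nonpos_of_setIntegral_exp_lt hM
  obtain ⟨T₀, hT₀⟩ := hint η hη
  set T := max T₀ 2 with hTdef
  have hT2 : 2 ≤ T := le_max_right _ _
  have hball : ∀ {q : ℂ}, 2 ≤ q.re → ∀ z ∈ ball q 2, 0 < z.re := fun hq z hz => by
    linarith [sub_lt_re_of_mem_ball hz]
  have hneg : ∀ z : ℂ, T ≤ z.re → W z ≤ 0 := by
    intro z hz
    have hb := hball (hT2.trans hz)
    exact hreg W z 2 (by norm_num) (hW.mono hb) (fun w hw => hΔ w (hb w hw))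
      (hT₀ z ((le_max_left _ _).trans hz))
  obtain ⟨z₀, hz₀, hmin⟩ := exists_isMinOn_circle (by linarith : 0 < T) hW.continuousOn hper
  obtain ⟨z₁, hz₁, hlt⟩ : ∃ z₁ : ℂ, T < z₁.re ∧ W z₁ < W z₀ := by
    by_contra! hcon
    have hge : ∀ z : ℂ, T ≤ z.re → W z₀ ≤ W z := fun z hz =>
      hz.eq_or_lt.elim (fun h => hmin z h.symm) (hcon z)
    obtain ⟨T', hT'⟩ := hint (π * Real.exp (W z₀)) (by positivity)
    set q : ℂ := ((max (T + 2) T' : ℝ) : ℂ)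
    have hqre : q.re = max (T + 2) T' := Complex.ofReal_re _
    have hqT : T + 2 ≤ q.re := hqre ▸ le_max_left _ _
    have h1 := hT' q (hqre ▸ le_max_right _ _)
    have hI : IntegrableOn (fun z => Real.exp (W z)) (ball q 1) := by
      refine ((Real.continuous_exp.comp_continuousOn (hW.continuousOn.mono fun z hz => ?_)
        ).integrableOn_compact (isCompact_closedBall q 1)).mono_set ball_subset_closedBall
      exact hball (by linarith) z (closedBall_subset_ball (by norm_num) hz)
    have h2 : ∫ _ in ball q 1, Real.exp (W z₀) ≤ ∫ z in ball q 1, Real.exp (W z) :=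
      setIntegral_mono_on (integrableOn_const measure_ball_lt_top.ne) hI measurableSet_ball
        fun z hz => Real.exp_le_exp.2 (hge z (by linarith [sub_lt_re_of_mem_ball hz]))
    rw [integral_ball_const q zero_le_one] at h2
    linarith
  have hz₁T : 0 < z₁.re - T := sub_pos.2 hz₁
  set s : ℝ := (W z₀ - W z₁) / 2 / (z₁.re - T) with hs
  have hs0 : 0 < s := by have := sub_pos.2 hlt; positivity
  have hs1 : s * (z₁.re - T) = (W z₀ - W z₁) / 2 := by rw [hs]; field_simp
  have hex : ∀ t, z₁.re ≤ t → ∃ z : ℂ, z.re = t ∧ W z ≤ W z₀ - s * (t - T) := by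
    intro t ht
    by_contra! hcon
    have := affine_le_of_laplacian_nonpos (a := W z₀) (b := -s) (by linarith : 0 < T) hW hper hΔ0
      hmin (fun z hz => by linarith [hcon z hz]) hz₁.le ht
    linarith
  refine ⟨s / 4, by positivity, 49 * M + (W z₀ + s * T) / 4, max z₁.re (T + 22),
    by linarith [le_max_right z₁.re (T + 22)], fun z hz => ?_⟩
  have hz2 : T + 22 ≤ z.re := (le_max_right _ _).trans hz
  refine ⟨hneg z (by linarith), ?_⟩
  obtain ⟨w, hw, hwle⟩ := hex z.re ((le_max_left _ _).trans hz)
  have hH := harnack_of_periodic (G := -W) (T := T) (c := M)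
    (hW.neg.mono fun z hz => lt_trans (by linarith) (show T < z.re from hz)) (by simp [hper])
    (fun z hz => by simpa using hneg z hz.le)
    (fun z hz => by
      rw [InnerProductSpace.laplacian_neg]; simpa using hΔ0 z (by linarith))
    (fun z hz => by
      have h1 := hΔ z (by linarith)
      have h2 : M * Real.exp (W z) ≤ M * 1 :=
        mul_le_mul_of_nonneg_left (Real.exp_le_one_iff.2 (hneg z hz.le)) hM
      rw [InnerProductSpace.laplacian_neg, Pi.neg_apply]; linarith) hw hz2
  simp only [Pi.neg_apply] at hH
  linarith

/-- Finite-energy solutions of `0 ≤ -ΔW ≤ M e^W` on a half-cylinder are asymptotically affine. -/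
theorem exists_abs_sub_mul_re_le (hM : 0 ≤ M) (hW : ContDiffOn ℝ 2 W {z | 0 < z.re})
    (hper : ∀ z, W (z + 2 * π * Complex.I) = W z) (hΔ0 : ∀ z : ℂ, 0 < z.re → Δ W z ≤ 0)
    (hΔ : ∀ z : ℂ, 0 < z.re → -(M * Real.exp (W z)) ≤ Δ W z)
    (hint : ∀ η > 0, ∃ T : ℝ, ∀ q : ℂ, T ≤ q.re → ∫ z in ball q 1, Real.exp (W z) < η) :
    ∃ a < 0, ∃ C T : ℝ, ∀ z : ℂ, T ≤ z.re → |W z - a * z.re| ≤ C := by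
  obtain ⟨ε, hε, C, T, hT, hdec⟩ := exists_le_sub_mul_re hM hW hper hΔ0 hΔ hint
  set B : ℝ := M * Real.exp C / ε ^ 2 with hB
  have hB0 : 0 ≤ B := by positivity
  set ψ : ℝ → ℝ := fun t => B * Real.exp (-ε * t) with hψ
  have hexpd : ∀ x, HasDerivAt (fun t => Real.exp (-ε * t)) (Real.exp (-ε * x) * (-ε)) x :=
    fun x => by simpa using ((hasDerivAt_id x).const_mul (-ε)).exp
  have hψd : ∀ x, HasDerivAt ψ (B * (Real.exp (-ε * x) * (-ε))) x := fun x =>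
    (hexpd x).const_mul B
  have hψd' : ∀ x, HasDerivAt (fun x => B * (Real.exp (-ε * x) * (-ε)))
      (B * (Real.exp (-ε * x) * (-ε) * (-ε))) x := fun x =>
    ((hexpd x).mul_const (-ε)).const_mul B
  have hψ0 : ∀ t, 0 ≤ ψ t := fun t => by positivity
  have hψB : ∀ t, 0 ≤ t → ψ t ≤ B := fun t ht => by
    have : Real.exp (-ε * t) ≤ 1 := Real.exp_le_one_iff.2 (by nlinarith)
    simpa [hψ] using mul_le_mul_of_nonneg_left this hB0
  have hψC : ContDiff ℝ 2 (fun z : ℂ => ψ z.re) := by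
    have : ContDiff ℝ 2 (fun z : ℂ => ψ (Complex.reCLM z)) := by simp only [hψ]; fun_prop
    exact this
  have hWT : ContDiffOn ℝ 2 W {z | T < z.re} := hW.mono fun z hz => hT.trans hz
  set V : ℂ → ℝ := -(W + fun z : ℂ => ψ z.re) with hV
  have hVC : ContDiffOn ℝ 2 V {z | T < z.re} := (hWT.add hψC.contDiffOn).neg
  have hVper : ∀ z, V (z + 2 * π * Complex.I) = V z := fun z => by simp [hV, hper]
  have hVΔ : ∀ z : ℂ, T < z.re → Δ V z ≤ 0 := by
    intro z hz
    rw [hV, InnerProductSpace.laplacian_neg, Pi.neg_apply,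
      (hWT.contDiffAt ((isOpen_lt_re T).mem_nhds hz)).laplacian_add hψC.contDiffAt,
      laplacian_comp_re hψd hψd']
    have h1 := hΔ z (hT.trans hz)
    have h2 : M * Real.exp (W z) ≤ M * Real.exp (C - ε * z.re) :=
      mul_le_mul_of_nonneg_left (Real.exp_le_exp.2 (hdec z hz.le).2) hM
    have h3 : B * (Real.exp (-ε * z.re) * (-ε) * (-ε)) = M * Real.exp (C - ε * z.re) := by
      rw [hB, sub_eq_add_neg, Real.exp_add, ← neg_mul]; field_simp
    linarith
  have hVW : ∀ z, V z = -(W z) - ψ z.re := fun z => by simp [hV]; ring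
  set t₀ : ℝ := T + 1 with ht₀
  have hTt₀ : T < t₀ := by linarith
  obtain ⟨zV, hzV, hVmin⟩ := exists_isMinOn_circle hTt₀ hVC.continuousOn hVper
  obtain ⟨zW, hzW, hWmin⟩ := exists_isMinOn_circle hTt₀ hWT.continuousOn hper
  set P : Set ℝ := {s | ∃ C' : ℝ, ∀ z : ℂ, t₀ ≤ z.re → C' + s * z.re ≤ V z} with hP
  have hPle : ∀ s ∈ P, ∀ z : ℂ, t₀ ≤ z.re → V zV + s * (z.re - t₀) ≤ V z := by
    rintro s ⟨C', hC'⟩ z hz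
    exact affine_le_of_laplacian_nonpos_of_le hTt₀ hVC hVper hVΔ hVmin
      (fun N => ⟨max N t₀, le_max_left _ _, fun w hw => by
        rw [← hw]; exact hC' w (hw ▸ le_max_right _ _)⟩) hz
  have hεP : ε ∈ P := ⟨-C - B, fun z hz => by
    rw [hVW]
    linarith [(hdec z (by linarith)).2, hψB z.re (by linarith)]⟩
  have hPbdd : BddAbove P := by
    refine ⟨V (t₀ + 1 : ℝ) - V zV, fun s hs => ?_⟩
    have := hPle s hs (t₀ + 1 : ℝ) (by simp only [Complex.ofReal_re]; linarith)
    simp only [Complex.ofReal_re] at this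
    linarith
  set b : ℝ := sSup P with hb
  have hεb : ε ≤ b := le_csSup hPbdd hεP
  have hble : ∀ z : ℂ, t₀ ≤ z.re → V zV + b * (z.re - t₀) ≤ V z := by
    intro z hz
    rcases hz.eq_or_lt with h | h
    · rw [← h]; simpa using hVmin z h.symm
    · have h1 : b ≤ (V z - V zV) / (z.re - t₀) := csSup_le ⟨ε, hεP⟩ fun s hs => by
        rw [le_div_iff₀ (by linarith)]; linarith [hPle s hs z hz]
      rw [le_div_iff₀ (by linarith)] at h1
      linarith
  have hsharp : ∀ δ > 0, ∀ N : ℝ, ∃ w : ℂ, N ≤ w.re ∧ t₀ ≤ w.re ∧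
      V w < V zV + (b + δ) * (w.re - t₀) := by
    intro δ hδ N
    by_contra! hcon
    have hbδ : 0 ≤ b + δ := by linarith
    have : b + δ ∈ P := by
      refine ⟨min (V zV - (b + δ) * t₀) (V zV - (b + δ) * |N|), fun z hz => ?_⟩
      rcases le_or_gt N z.re with h | h
      · linarith [hcon z h hz, min_le_left (V zV - (b + δ) * t₀) (V zV - (b + δ) * |N|)]
      · have h1 := hble z hz
        have h2 : 0 ≤ b * (z.re - t₀) := mul_nonneg (by linarith) (by linarith)
        have h3 : (b + δ) * z.re ≤ (b + δ) * |N| :=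
          mul_le_mul_of_nonneg_left (h.le.trans (le_abs_self N)) hbδ
        linarith [min_le_right (V zV - (b + δ) * t₀) (V zV - (b + δ) * |N|)]
    linarith [le_csSup hPbdd this]
  set ℓ : ℝ → ℝ := fun t => -(V zV) - b * (t - t₀) with hℓ
  have hℓd : ∀ x, HasDerivAt ℓ (-b) x := fun x => by
    simpa using (((hasDerivAt_id x).sub_const t₀).const_mul b).const_sub (-(V zV))
  have hℓC : ContDiff ℝ 2 (fun z : ℂ => ℓ z.re) := by
    have : ContDiff ℝ 2 (fun z : ℂ => ℓ (Complex.reCLM z)) := by simp only [hℓ]; fun_prop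
    exact this
  set G : ℂ → ℝ := (fun z : ℂ => ℓ z.re) - W with hG
  have hWt₀ : ContDiffOn ℝ 2 W {z | t₀ < z.re} := hWT.mono fun z hz => hTt₀.trans hz
  have hGΔ : ∀ z : ℂ, t₀ < z.re → Δ G z = -(Δ W z) := by
    intro z hz
    rw [hG, hℓC.contDiffAt.laplacian_sub (hWt₀.contDiffAt ((isOpen_lt_re t₀).mem_nhds hz)),
      laplacian_comp_re hℓd (fun x => hasDerivAt_const x (-b)), zero_sub]
  have hGV : ∀ z, G z = ℓ z.re + V z + ψ z.re := fun z => by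
    rw [hVW]; simp [hG]; ring
  have hHar : ∀ {p q : ℂ}, p.re = q.re → t₀ + 22 ≤ q.re → G p ≤ 4 * (G q + 49 * M) := by
    intro p q hpq hq
    refine harnack_of_periodic (G := G) (hℓC.contDiffOn.sub hWt₀) (by simp [hG, hper]) (fun z hz => ?_)
      (fun z hz => ?_) (fun z hz => ?_) hpq hq
    · rw [hGV]
      linarith [hble z hz.le, hψ0 z.re]
    · rw [hGΔ z hz]; linarith [hΔ0 z (by linarith)]
    · rw [hGΔ z hz]
      have h2 : M * Real.exp (W z) ≤ M * 1 :=
        mul_le_mul_of_nonneg_left (Real.exp_le_one_iff.2 (hdec z (by linarith)).1) hM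
      linarith [hΔ z (by linarith)]
  have hlow : ∀ δ > 0, ∀ z : ℂ, t₀ ≤ z.re → W zW + (-b - 4 * δ) * (z.re - t₀) ≤ W z := by
    intro δ hδ z hz
    refine affine_le_of_laplacian_nonpos_of_le
      (C := -(V zV) + b * t₀ + 4 * δ * t₀ - 4 * B - 196 * M) hTt₀ hWT hper
      (fun z hz => hΔ0 z (hT.trans hz)) hWmin (fun N => ?_) hz
    obtain ⟨w, hw, hw2, hw3⟩ := hsharp δ hδ (max N (t₀ + 22))
    refine ⟨w.re, (le_max_left _ _).trans hw, fun p hp => ?_⟩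
    have h1 := hHar hp ((le_max_right _ _).trans hw)
    rw [hGV w] at h1
    have h2 : G p = ℓ w.re - W p := by simp [hG, hp]
    rw [h2] at h1
    have h3 := hψB w.re (by linarith)
    simp only [hℓ] at h1
    linarith
  have hlow' : ∀ z : ℂ, t₀ ≤ z.re → W zW - b * (z.re - t₀) ≤ W z := by
    intro z hz
    refine le_of_forall_pos_sub_le fun δ hδ => ?_
    have h0 : 0 ≤ z.re - t₀ := sub_nonneg.2 hz
    have h := hlow (δ / (4 * (z.re - t₀ + 1))) (by positivity) z hz
    have h2 : 4 * (δ / (4 * (z.re - t₀ + 1))) * (z.re - t₀) ≤ δ := by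
      have : 4 * (δ / (4 * (z.re - t₀ + 1))) * (z.re - t₀) =
          δ * (z.re - t₀) / (z.re - t₀ + 1) := by field_simp
      rw [this, div_le_iff₀ (by positivity)]
      nlinarith
    linarith
  refine ⟨-b, by linarith, |W zW| + |V zV| + |b * t₀|, t₀, fun z hz => abs_le.2 ⟨?_, ?_⟩⟩
  · linarith [hlow' z hz, neg_abs_le (W zW), neg_abs_le (b * t₀), abs_nonneg (V zV)]
  · have h1 := hble z hz
    rw [hVW z] at h1
    linarith [hψ0 z.re, neg_abs_le (V zV), le_abs_self (b * t₀), abs_nonneg (W zW)]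

end HalfCylinder

theorem lap_eq_sum_fderiv_fderiv {n : ℕ} {v : EuclideanSpace ℝ (Fin n) → ℝ}
    {x : EuclideanSpace ℝ (Fin n)} (hv : ContDiffAt ℝ 2 v x) :
    lap v x = ∑ i, fderiv ℝ (fderiv ℝ v) x (EuclideanSpace.single i 1)
      (EuclideanSpace.single i 1) := by
  refine Finset.sum_congr rfl fun i _ => ?_
  have h := ((hv.fderiv_right (m := 1) (by norm_num)).differentiableAt (by simp)).hasFDerivAt
  have h2 : HasFDerivAt (pderiv1 i v) _ x :=
    (ContinuousLinearMap.apply ℝ ℝ (EuclideanSpace.single i (1 : ℝ))).hasFDerivAt.comp x h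
  rw [pderiv1, h2.fderiv]
  rfl

theorem laplacian_comp_orthonormalBasisOneI_repr {v : EuclideanSpace ℝ (Fin 2) → ℝ} {z : ℂ}
    (hv : ContDiffAt ℝ 2 v (Complex.orthonormalBasisOneI.repr z)) :
    Δ (fun y => v (Complex.orthonormalBasisOneI.repr y)) z =
      lap v (Complex.orthonormalBasisOneI.repr z) := by
  set L : ℂ ≃L[ℝ] EuclideanSpace ℝ (Fin 2) :=
    Complex.orthonormalBasisOneI.repr.toContinuousLinearEquiv with hL
  have e0 : Complex.orthonormalBasisOneI.repr 1 = EuclideanSpace.single 0 (1 : ℝ) := by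
    ext i; fin_cases i <;> simp
  have e1 : Complex.orthonormalBasisOneI.repr Complex.I = EuclideanSpace.single 1 (1 : ℝ) := by
    ext i; fin_cases i <;> simp
  have h1 : fderiv ℝ (fun y => v (Complex.orthonormalBasisOneI.repr y)) =
      fun y => (fderiv ℝ v (L y)).comp (L : ℂ →L[ℝ] EuclideanSpace ℝ (Fin 2)) :=
    funext fun y => L.comp_right_fderiv (f := v)
  have h2 : HasFDerivAt (fderiv ℝ v) (fderiv ℝ (fderiv ℝ v) (L z)) (L z) :=
    ((hv.fderiv_right (m := 1) (by norm_num)).differentiableAt (by simp)).hasFDerivAt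
  have h3 : HasFDerivAt (fun y => fderiv ℝ v (L y)) _ z := h2.comp z L.hasFDerivAt
  have h4 := (h3.clm_comp
    (hasFDerivAt_const (L : ℂ →L[ℝ] EuclideanSpace ℝ (Fin 2)) z)).fderiv
  rw [laplacian_eq_fderiv_fderiv, h1, h4, lap_eq_sum_fderiv_fderiv hv, Fin.sum_univ_two,
    ← e0, ← e1]
  simp [hL]

theorem injOn_exp_ball (q : ℂ) : InjOn Complex.exp (ball q 1) := by
  intro z hz w hw h
  obtain ⟨n, hn⟩ := Complex.exp_eq_exp_iff_exists_int.1 h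
  have hd : ‖z - w‖ < 2 := by
    rw [← dist_eq_norm]
    linarith [dist_triangle_right z w q, mem_ball.1 hz, mem_ball.1 hw]
  rw [hn, add_sub_cancel_left] at hd
  have h2 : |(n : ℝ)| * (2 * π) < 2 := by
    simpa [abs_of_pos pi_pos] using hd
  have h3 : |(n : ℝ)| < 1 := by nlinarith [pi_gt_three, abs_nonneg (n : ℝ)]
  have h4 : n = 0 := Int.abs_lt_one_iff.1 (by exact_mod_cast h3)
  simpa [h4] using hn

theorem setIntegral_comp_exp {s : Set ℂ} (hs : MeasurableSet s) (hinj : InjOn Complex.exp s)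
    (f : ℂ → ℝ) :
    ∫ z in s, ‖Complex.exp z‖ ^ 2 * f (Complex.exp z) = ∫ y in Complex.exp '' s, f y := by
  rw [integral_image_eq_integral_abs_det_fderiv_smul volume hs
    (fun z _ => ((Complex.hasDerivAt_exp z).hasFDerivAt.restrictScalars ℝ).hasFDerivWithinAt)
    hinj]
  refine integral_congr_ae (Eventually.of_forall fun z => ?_)
  simp [ContinuousLinearMap.det, LinearMap.det_restrictScalars, Complex.sq_norm,
    Algebra.norm_complex_apply, abs_of_nonneg (Complex.normSq_nonneg _)]

theorem exists_setIntegral_ball_comp_exp_lt {f : ℂ → ℝ} (hf0 : ∀ y, 0 ≤ f y)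
    (hf : IntegrableOn f (closedBall 0 1)ᶜ) {η : ℝ} (hη : 0 < η) :
    ∃ T : ℝ, ∀ q : ℂ, T ≤ q.re →
      ∫ z in ball q 1, ‖Complex.exp z‖ ^ 2 * f (Complex.exp z) < η := by
  have ht : Tendsto (fun n : ℕ => ∫ y in (closedBall (0 : ℂ) (n + 1))ᶜ, f y) atTop (𝓝 0) := by
    have h := tendsto_setIntegral_of_antitone (μ := volume) (f := f)
      (s := fun n : ℕ => (closedBall (0 : ℂ) (n + 1))ᶜ)
      (fun n => measurableSet_closedBall.compl)
      (fun m n hmn => compl_subset_compl.2 (closedBall_subset_closedBall (by gcongr)))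
      ⟨0, by simpa using hf⟩
    have h2 : ⋂ n : ℕ, (closedBall (0 : ℂ) (n + 1))ᶜ = ∅ := by
      refine eq_empty_of_forall_notMem fun y hy => ?_
      obtain ⟨n, hn⟩ := exists_nat_gt ‖y‖
      have := mem_iInter.1 hy n
      simp at this
      linarith
    simpa [h2] using h
  obtain ⟨n, hn⟩ := (ht.eventually_lt_const hη).exists
  refine ⟨Real.log (n + 1) + 1, fun q hq => ?_⟩
  rw [setIntegral_comp_exp measurableSet_ball (injOn_exp_ball q)]
  refine (setIntegral_mono_set (hf.mono_set ?_) (Eventually.of_forall hf0)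
    (LE.le.eventuallyLE ?_)).trans_lt hn
  · exact compl_subset_compl.2 (closedBall_subset_closedBall (by simp))
  · rintro _ ⟨z, hz, rfl⟩
    have h := sub_lt_re_of_mem_ball hz
    have h2 : (n + 1 : ℝ) < Real.exp z.re :=
      (Real.log_lt_iff_lt_exp (by positivity)).1 (by linarith)
    simpa [Complex.norm_exp] using h2

/-- asymptotics at infinity for the Gaussian curvature equation
`-Δv = K e^v` on the exterior of the closed unit disc in `ℝ²`. -/
theorem stmt_1 (K v : EuclideanSpace ℝ (Fin 2) → ℝ)
    (hK0 : ∀ x ∈ (closedBall (0 : EuclideanSpace ℝ (Fin 2)) 1)ᶜ, 0 ≤ K x)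
    (hKbdd : ∃ M : ℝ, ∀ x ∈ (closedBall (0 : EuclideanSpace ℝ (Fin 2)) 1)ᶜ, K x ≤ M)
    (hv : ContDiffOn ℝ 2 v (closedBall (0 : EuclideanSpace ℝ (Fin 2)) 1)ᶜ)
    (heq : ∀ x ∈ (closedBall (0 : EuclideanSpace ℝ (Fin 2)) 1)ᶜ,
      -(lap v x) = K x * Real.exp (v x))
    (hint : IntegrableOn (fun x => Real.exp (v x))
      (closedBall (0 : EuclideanSpace ℝ (Fin 2)) 1)ᶜ) :
    ∃ β : ℝ, β < -2 ∧ ∃ C > (0 : ℝ), ∃ R : ℝ,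
      ∀ x : EuclideanSpace ℝ (Fin 2), R ≤ ‖x‖ →
        |v x - β * Real.log ‖x‖| ≤ C := by
  obtain ⟨M, hM⟩ := hKbdd
  set ι := Complex.orthonormalBasisOneI.repr with hι
  set u : ℂ → ℝ := fun y => v (ι y) with hu
  have hmem : ∀ z : ℂ, 0 < z.re →
      ι (Complex.exp z) ∈ (closedBall (0 : EuclideanSpace ℝ (Fin 2)) 1)ᶜ := fun z hz => by
    simpa [Complex.norm_exp] using hz
  have hvat : ∀ z : ℂ, 0 < z.re → ContDiffAt ℝ 2 v (ι (Complex.exp z)) := fun z hz =>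
    hv.contDiffAt (isClosed_closedBall.isOpen_compl.mem_nhds (hmem z hz))
  have huat : ∀ z : ℂ, 0 < z.re → ContDiffAt ℝ 2 u (Complex.exp z) := fun z hz =>
    (hvat z hz).comp _ ι.contDiff.contDiffAt
  set W : ℂ → ℝ := (fun z => u (Complex.exp z)) + fun z => 2 * z.re with hW
  have hexp : ContDiff ℝ 2 Complex.exp := Complex.contDiff_exp
  have h1 : ∀ z : ℂ, 0 < z.re → ContDiffAt ℝ 2 (fun z => u (Complex.exp z)) z := fun z hz =>
    (huat z hz).comp z hexp.contDiffAt
  have h2 : ContDiff ℝ 2 (fun z : ℂ => 2 * z.re) := contDiff_const.mul Complex.reCLM.contDiff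
  have hWexp : ∀ z, Real.exp (W z) = ‖Complex.exp z‖ ^ 2 * Real.exp (u (Complex.exp z)) := by
    intro z
    rw [hW, Pi.add_apply, Real.exp_add, Complex.norm_exp, ← Real.exp_nat_mul, mul_comm]
    norm_num
  have hΔ : ∀ z : ℂ, 0 < z.re → Δ W z = -(K (ι (Complex.exp z)) * Real.exp (W z)) := by
    intro z hz
    rw [hWexp, hW, (h1 z hz).laplacian_add h2.contDiffAt,
      laplacian_comp_conformal Complex.hasDerivAt_exp Complex.hasDerivAt_exp (huat z hz),
      laplacian_comp_re (g := fun t => 2 * t) (fun t => by simpa using (hasDerivAt_id t).const_mul 2)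
        (fun t => hasDerivAt_const t 2), hu,
      laplacian_comp_orthonormalBasisOneI_repr (hvat z hz)]
    linear_combination -‖Complex.exp z‖ ^ 2 * heq _ (hmem z hz)
  obtain ⟨a, ha, C, T, hC⟩ : ∃ a < 0, ∃ C T : ℝ, ∀ z : ℂ, T ≤ z.re → |W z - a * z.re| ≤ C := by
    refine exists_abs_sub_mul_re_le (le_max_right M 0)
      (fun z hz => ((h1 z hz).add h2.contDiffAt).contDiffWithinAt) (fun z => ?_) (fun z hz => ?_)
      (fun z hz => ?_) fun η hη => ?_
    · simp [hW, Complex.exp_periodic z]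
    · rw [hΔ z hz]
      exact neg_nonpos.2 (mul_nonneg (hK0 _ (hmem z hz)) (Real.exp_pos _).le)
    · rw [hΔ z hz]
      exact neg_le_neg (mul_le_mul_of_nonneg_right
        ((hM _ (hmem z hz)).trans (le_max_left _ _)) (Real.exp_pos _).le)
    · simp only [hWexp]
      refine exists_setIntegral_ball_comp_exp_lt (f := fun y => Real.exp (u y))
        (fun y => (Real.exp_pos _).le) ?_ hη
      have h := (ι.measurePreserving.integrableOn_comp_preimage
        ι.toHomeomorph.measurableEmbedding).2 hint
      have hs : ι ⁻¹' (closedBall 0 1)ᶜ = (closedBall 0 1)ᶜ := by ext y; simp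
      rwa [hs] at h
  refine ⟨a - 2, by linarith, |C| + 1, by positivity, Real.exp T, fun x hx => ?_⟩
  have hx0 : ι.symm x ≠ 0 := by
    rw [← norm_pos_iff, ι.symm.norm_map]
    exact (Real.exp_pos T).trans_le hx
  have hre : (Complex.log (ι.symm x)).re = Real.log ‖x‖ := by
    rw [Complex.log_re, ι.symm.norm_map]
  have h := hC (Complex.log (ι.symm x))
    (by rw [hre]; exact (Real.le_log_iff_exp_le ((Real.exp_pos T).trans_le hx)).2 hx)
  simp only [hW, hu, Pi.add_apply, Complex.exp_log hx0, hre, ι.apply_symm_apply] at h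
  rw [show v x - (a - 2) * Real.log ‖x‖ = v x + 2 * Real.log ‖x‖ - a * Real.log ‖x‖ by ring]
  linarith [le_abs_self C]

end
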